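/- Let A be a densely defined closed symmetric operator on a complex separable Hilbert space H, let D be a subspace with dom(A) ⊆ D ⊆ dom(A*) such that A_D := A*|_D is self-adjoint, and let t ↦ C_t be a norm-continuous curve of bounded self-adjoint operators on H such that for each t the operator (A + C_t)_D is self-adjoint Fredholm and A + C_t satisfies weak inner unique continuation with margin, i.e. ker(A* + C_t + s) ∩ dom(A) = {0} for all s with |s| sufficiently small. Then the curve t ↦ CD(A + C_t) := γ(ker(A* + C_t)) is a continuous curve of closed subspaces of the Hilbert space β(A): the orthogonal projections P_t of β(A) onto CD(A + C_t) (with respect to the inner product induced by the graph inner product of A*) depend norm-continuously on t. -/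

import Mathlib

open scoped ComplexInnerProductSpace

noncomputable section

variable {H : Type*} [NormedAddCommGroup H] [InnerProductSpace ℂ H] [CompleteSpace H]

/-- `dom A` viewed as a submodule of `dom A†` (for symmetric `A` one has `dom A ⊆ dom A†`). -/
def minDom (A : H →ₗ.[ℂ] H) : Submodule ℂ A.adjoint.domain :=
  A.domain.comap A.adjoint.domain.subtype

/-- The abstract boundary space `β(A) := dom A† / dom A`. -/
abbrev beta (A : H →ₗ.[ℂ] H) := A.adjoint.domain ⧸ minDom A

/-- The natural quotient map `γ : dom A† → β(A)`. -/
def gammaMap (A : H →ₗ.[ℂ] H) : A.adjoint.domain →ₗ[ℂ] beta A :=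
  (minDom A).mkQ

/-- The Green form `ω(x,y) := ⟪A† x, y⟫ - ⟪x, A† y⟫` on `dom A†`. -/
def omegaForm (A : H →ₗ.[ℂ] H) (x y : A.adjoint.domain) : ℂ :=
  ⟪A.adjoint x, (y : H)⟫ - ⟪(x : H), A.adjoint y⟫

/-- The induced form `ω̂` on `β(A)`, computed on representatives.  (For a closed symmetric `A`
this is well defined, i.e. independent of the representatives.) -/
def omegaHat (A : H →ₗ.[ℂ] H) (v w : beta A) : ℂ :=
  omegaForm A (Quotient.out v) (Quotient.out w)

/-- The restriction `A_D := A†|_D` of the adjoint to an intermediate subspace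
`dom A ⊆ D ⊆ dom A†`, as a partially defined operator on `H`. -/
def adjRestrict (A : H →ₗ.[ℂ] H) (D : Submodule ℂ A.adjoint.domain) : H →ₗ.[ℂ] H :=
  A.adjoint.domRestrict (D.map A.adjoint.domain.subtype)
/-- The graph norm on the domain of the adjoint `A†`. -/
def graphNorm (A : H →ₗ.[ℂ] H) (x : A.adjoint.domain) : ℝ :=
  Real.sqrt (‖(x : H)‖ ^ 2 + ‖A.adjoint x‖ ^ 2)

/-- The quotient norm on `β(A)` induced by the graph norm of `A†`. -/
def quotNorm (A : H →ₗ.[ℂ] H) (v : beta A) : ℝ :=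
  sInf (graphNorm A '' {x : A.adjoint.domain | Submodule.Quotient.mk x = v})

/-- The operator `A + C` with domain `dom A`, for a bounded operator `C`. -/
def addBdd (A : H →ₗ.[ℂ] H) (C : H →L[ℂ] H) : H →ₗ.[ℂ] H :=
  A + (C : H →ₗ[ℂ] H).toPMap ⊤

/-- `ker (A† + C) = {x ∈ dom A† : A† x + C x = 0}` as a submodule of `dom A†`. -/
def pertKer (A : H →ₗ.[ℂ] H) (C : H →L[ℂ] H) : Submodule ℂ A.adjoint.domain :=
  LinearMap.ker (A.adjoint.toFun + (C : H →ₗ[ℂ] H).comp A.adjoint.domain.subtype)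

/-- The Cauchy data space `CD(A + C) := γ(ker (A† + C)) ⊆ β(A)`. -/
def pertCauchyData (A : H →ₗ.[ℂ] H) (C : H →L[ℂ] H) : Submodule ℂ (beta A) :=
  (pertKer A C).map (gammaMap A)

/-- The extension `(A + C)_D := (A + C)†|_D` of the perturbed operator. -/
def pertRestrict (A : H →ₗ.[ℂ] H) (C : H →L[ℂ] H) (D : Submodule ℂ A.adjoint.domain) :
    H →ₗ.[ℂ] H :=
  (addBdd A C).adjoint.domRestrict (D.map A.adjoint.domain.subtype)

section AbstractLemmas

variable {E : Type*} [NormedAddCommGroup E] [InnerProductSpace ℂ E] [CompleteSpace E]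

/-- A surjective bounded operator stays uniformly surjective under small perturbations. -/
lemma aux_correct (T : E →L[ℂ] H) (hT : T.range = ⊤) :
    ∃ n > (0 : ℝ), ∀ η : ℝ, 0 ≤ η → η ≤ n⁻¹ / 2 → ∀ f : E →L[ℂ] H, ‖f - T‖ ≤ η →
      ∀ z : E, ‖f z‖ ≤ η * ‖z‖ → ∃ z' : E, f z' = 0 ∧ ‖z' - z‖ ≤ 2 * n * η * ‖z‖ := by
  obtain ⟨R, hR⟩ := T.exists_nonlinearRightInverse_of_surjective hT
  have hn : (0 : ℝ) < R.nnnorm := by exact_mod_cast hR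
  refine ⟨R.nnnorm, hn, fun η h0 hη f hf z hz => ?_⟩
  have happ : ApproximatesLinearOn f T Set.univ (⟨η, h0⟩ : NNReal) := by
    intro x _ y _
    rw [← map_sub]
    exact ((f - T).le_opNorm (x - y)).trans (by gcongr; exact hf)
  have h := happ.surjOn_closedBall_of_nonlinearRightInverse R (b := z)
    (ε := 2 * R.nnnorm * η * ‖z‖) (by positivity) (Set.subset_univ _)
  have h0m : (0 : H) ∈ Metric.closedBall (f z)
      (((R.nnnorm : ℝ)⁻¹ - (⟨η, h0⟩ : NNReal)) * (2 * R.nnnorm * η * ‖z‖)) := by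
    rw [mem_closedBall_iff_norm, zero_sub, norm_neg]
    refine hz.trans ?_
    calc η * ‖z‖ = ((R.nnnorm : ℝ)⁻¹ / 2) * (2 * R.nnnorm * η * ‖z‖) := by field_simp
      _ ≤ _ := by
        gcongr
        change _ ≤ _ - η
        linarith
  obtain ⟨z', hball, hfz⟩ := h h0m
  exact ⟨z', hfz, mem_closedBall_iff_norm.1 hball⟩

/-- Uniform lower bound for the projection to `Mᗮ` on kernels. -/
lemma aux_lower (T : E →L[ℂ] H) (M : Submodule ℂ E) [M.HasOrthogonalProjection]
    (a : ℝ) (ha : 0 < a) (hM : ∀ m ∈ M, a * ‖m‖ ≤ ‖T m‖) (f : E →L[ℂ] H)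
    (hf : ‖f - T‖ ≤ a / 2) (hf1 : ‖f - T‖ ≤ 1) (z : E) (hz : f z = 0) :
    ‖z‖ ≤ (1 + 2 / a * (‖T‖ + 1)) * ‖Mᗮ.starProjection z‖ := by
  set q := Mᗮ.starProjection z with hq
  set m := M.starProjection z with hm
  have hsum : m + q = z := M.starProjection_add_starProjection_orthogonal z
  have hmM : m ∈ M := M.starProjection_apply_mem z
  have h1 : f m = - f q := by
    rw [eq_neg_iff_add_eq_zero, ← map_add, hsum, hz]
  have h2 : ‖f‖ ≤ ‖T‖ + 1 := by
    calc ‖f‖ = ‖T + (f - T)‖ := by congr 1; abel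
      _ ≤ _ := (norm_add_le _ _).trans (by gcongr)
  have h3 : ‖f m‖ ≤ (‖T‖ + 1) * ‖q‖ := by
    rw [h1, norm_neg]; exact (f.le_opNorm q).trans (by gcongr)
  have h4 : ‖T m‖ ≤ ‖f m‖ + a / 2 * ‖m‖ := by
    calc ‖T m‖ = ‖f m - (f - T) m‖ := by simp
      _ ≤ ‖f m‖ + ‖(f - T) m‖ := norm_sub_le _ _
      _ ≤ _ := by gcongr; exact ((f - T).le_opNorm m).trans (by gcongr)
  have h5 : a / 2 * ‖m‖ ≤ (‖T‖ + 1) * ‖q‖ := by linarith [hM m hmM]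
  have h6 : ‖m‖ ≤ 2 / a * (‖T‖ + 1) * ‖q‖ := by
    calc ‖m‖ = 2 / a * (a / 2 * ‖m‖) := by field_simp
      _ ≤ 2 / a * ((‖T‖ + 1) * ‖q‖) := by gcongr
      _ = _ := by ring
  calc ‖z‖ ≤ ‖m‖ + ‖q‖ := by rw [← hsum]; exact norm_add_le _ _
    _ ≤ _ := by linarith

/-- Two orthogonal projections are close if the subspaces are close. -/
lemma aux_proj (S₁ S₂ : Set E) (ε : ℝ) (hε : 0 ≤ ε)
    (h12 : ∀ u ∈ S₁, ∃ u' ∈ S₂, ‖u - u'‖ ≤ ε * ‖u‖)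
    (h21 : ∀ u ∈ S₂, ∃ u' ∈ S₁, ‖u - u'‖ ≤ ε * ‖u‖)
    (v a b : E) (ha : a ∈ S₁) (hb : b ∈ S₂)
    (hao : ∀ w ∈ S₁, ⟪v - a, w⟫ = 0) (hbo : ∀ w ∈ S₂, ⟪v - b, w⟫ = 0) :
    ‖a - b‖ ^ 2 ≤ 2 * ε * ‖v‖ ^ 2 := by
  have key : ∀ c : E, ⟪v - c, c⟫ = 0 → ‖c‖ ≤ ‖v‖ ∧ ‖v - c‖ ≤ ‖v‖ := by
    intro c hc
    have := norm_add_sq_eq_norm_sq_add_norm_sq_of_inner_eq_zero (𝕜 := ℂ) (v - c) c hc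
    rw [sub_add_cancel] at this
    constructor <;> nlinarith [norm_nonneg c, norm_nonneg (v - c), norm_nonneg v]
  obtain ⟨a', ha', haa⟩ := h12 a ha
  obtain ⟨b', hb', hbb⟩ := h21 b hb
  obtain ⟨ka, ka'⟩ := key a (hao a ha)
  obtain ⟨kb, kb'⟩ := key b (hbo b hb)
  have e : ⟪a - b, a - b⟫ = ⟪v - b, a - a'⟫ + ⟪v - a, b - b'⟫ := by
    have e1 : ⟪a - b, a - b⟫ = ⟪(v - b) - (v - a), a - b⟫ := by congr 1; abel
    rw [e1, inner_sub_left, inner_sub_right, inner_sub_right, inner_sub_right, inner_sub_right,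
      hao a ha, hbo b hb, hao b' hb', hbo a' ha']
    ring
  have e2 : ‖a - b‖ ^ 2 = ‖⟪a - b, a - b⟫‖ := by
    rw [inner_self_eq_norm_sq_to_K]; simp
  rw [e2, e]
  calc _ ≤ ‖⟪v - b, a - a'⟫‖ + ‖⟪v - a, b - b'⟫‖ := norm_add_le _ _
    _ ≤ ‖v - b‖ * ‖a - a'‖ + ‖v - a‖ * ‖b - b'‖ :=
        add_le_add (norm_inner_le_norm _ _) (norm_inner_le_norm _ _)
    _ ≤ ‖v‖ * (ε * ‖v‖) + ‖v‖ * (ε * ‖v‖) := by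
        have i1 : ‖a - a'‖ ≤ ε * ‖v‖ := haa.trans (by gcongr)
        have i2 : ‖b - b'‖ ≤ ε * ‖v‖ := hbb.trans (by gcongr)
        gcongr
    _ = _ := by ring

/-- The abstract continuity statement. -/
lemma aux_main (T : ℝ → E →L[ℂ] H) (hTc : Continuous T) (M : Submodule ℂ E)
    [M.HasOrthogonalProjection] (t : ℝ) (hsurj : (T t).range = ⊤)
    (a : ℝ) (ha : 0 < a) (hM : ∀ m ∈ M, a * ‖m‖ ≤ ‖T t m‖) (ε : ℝ) (hε : 0 < ε) :
    ∃ δ > (0 : ℝ), ∀ s : ℝ, |s - t| < δ → ∀ v x y : E,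
      x ∈ Mᗮ.starProjection '' {z | T s z = 0} → y ∈ Mᗮ.starProjection '' {z | T t z = 0} →
      (∀ w ∈ Mᗮ.starProjection '' {z | T s z = 0}, ⟪v - x, w⟫ = 0) →
      (∀ w ∈ Mᗮ.starProjection '' {z | T t z = 0}, ⟪v - y, w⟫ = 0) →
      ‖x - y‖ ≤ ε * ‖v‖ := by
  obtain ⟨n, hn, hcor⟩ := aux_correct (T t) hsurj
  set B := 1 + 2 / a * (‖T t‖ + 1) with hB
  have hBpos : 0 < B := by positivity
  set θ := ε ^ 2 / 2 with hθ
  have hθpos : 0 < θ := by positivity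
  obtain ⟨η, hη0, h1, h2, h3, h4⟩ : ∃ η > (0 : ℝ), η ≤ n⁻¹ / 2 ∧ η ≤ a / 2 ∧ η ≤ 1 ∧
      2 * n * η * B ≤ θ := by
    refine ⟨min (min (n⁻¹ / 2) (a / 2)) (min 1 (θ / (2 * n * B))), by positivity, ?_, ?_, ?_, ?_⟩
    · exact (min_le_left _ _).trans (min_le_left _ _)
    · exact (min_le_left _ _).trans (min_le_right _ _)
    · exact (min_le_right _ _).trans (min_le_left _ _)
    · have h : min (min (n⁻¹ / 2) (a / 2)) (min 1 (θ / (2 * n * B))) ≤ θ / (2 * n * B) :=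
        (min_le_right _ _).trans (min_le_right _ _)
      rw [le_div_iff₀ (by positivity)] at h
      linarith
  obtain ⟨δ, hδ, hδT⟩ := Metric.continuous_iff.1 hTc t η hη0
  refine ⟨δ, hδ, fun s hs v x y hx hy hxo hyo => ?_⟩
  have hd : ‖T s - T t‖ ≤ η := by
    have := hδT s (by rwa [Real.dist_eq])
    rw [dist_eq_norm] at this
    exact this.le
  have hd0 : ‖T t - T t‖ ≤ η := by simpa using hη0.le
  have gap : ∀ f g : E →L[ℂ] H, ‖f - T t‖ ≤ η → ‖g - T t‖ ≤ η → ‖g - f‖ ≤ η →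
      ∀ u ∈ Mᗮ.starProjection '' {z | f z = 0}, ∃ u' ∈ Mᗮ.starProjection '' {z | g z = 0},
        ‖u - u'‖ ≤ θ * ‖u‖ := by
    rintro f g hf hg hfg _ ⟨z, hz, rfl⟩
    have hz : f z = 0 := hz
    have hgz : ‖g z‖ ≤ η * ‖z‖ := by
      have : g z = (g - f) z := by simp [hz]
      rw [this]
      exact ((g - f).le_opNorm z).trans (by gcongr)
    obtain ⟨z', hz', hzz⟩ := hcor η hη0.le h1 g hg z hgz
    refine ⟨_, ⟨z', hz', rfl⟩, ?_⟩
    have hl := aux_lower (T t) M a ha hM f (hf.trans h2) (hf.trans h3) z hz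
    rw [← map_sub]
    calc ‖Mᗮ.starProjection (z - z')‖ ≤ ‖z - z'‖ := Mᗮ.norm_starProjection_apply_le _
      _ = ‖z' - z‖ := norm_sub_rev _ _
      _ ≤ 2 * n * η * ‖z‖ := hzz
      _ ≤ 2 * n * η * (B * ‖Mᗮ.starProjection z‖) := by gcongr
      _ = 2 * n * η * B * ‖Mᗮ.starProjection z‖ := by ring
      _ ≤ _ := by gcongr
  have hfin := aux_proj _ _ θ hθpos.le (gap (T s) (T t) hd hd0 (by rwa [norm_sub_rev]))
    (gap (T t) (T s) hd0 hd hd) v x y hx hy hxo hyo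
  have : ‖x - y‖ ^ 2 ≤ (ε * ‖v‖) ^ 2 := by
    rw [mul_pow]; rw [hθ] at hfin; linarith
  exact le_of_sq_le_sq this (by positivity)

/-- Injective restrictions of semi-Fredholm operators are bounded below. -/
lemma aux_semiFredholm (T : E →L[ℂ] H) (DD M : Submodule ℂ E) (hDD : IsClosed (DD : Set E))
    (hMc : IsClosed (M : Set E)) (hMD : M ≤ DD)
    (hr : IsClosed ((DD.map T.toLinearMap : Submodule ℂ H) : Set H))
    (hk : FiniteDimensional ℂ (DD ⊓ T.ker : Submodule ℂ E))
    (hinj : ∀ m ∈ M, T m = 0 → m = 0) :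
    ∃ a > (0 : ℝ), ∀ m ∈ M, a * ‖m‖ ≤ ‖T m‖ := by
  have hsup : IsClosed ((M ⊔ (DD ⊓ T.ker) : Submodule ℂ E) : Set E) :=
    Submodule.isClosed_sup_finiteDimensional _ _ hMc
  have : CompleteSpace DD := hDD.completeSpace_coe
  have : CompleteSpace M := hMc.completeSpace_coe
  have : CompleteSpace (DD.map T.toLinearMap) := hr.completeSpace_coe
  let g : DD →L[ℂ] (DD.map T.toLinearMap) :=
    (T.comp DD.subtypeL).codRestrict _ (fun x => ⟨x, x.2, rfl⟩)
  have hgs : Function.Surjective g := by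
    rintro ⟨_, x, hx, rfl⟩
    exact ⟨⟨x, hx⟩, rfl⟩
  have hq := g.isQuotientMap hgs
  have hcl1 : IsClosed ((fun r : DD.map T.toLinearMap => (r : H)) ⁻¹' (T '' M)) := by
    rw [← hq.isClosed_preimage]
    have : g ⁻¹' ((fun r : DD.map T.toLinearMap => (r : H)) ⁻¹' (T '' M)) =
        (fun d : DD => (d : E)) ⁻¹' ((M ⊔ (DD ⊓ T.ker) : Submodule ℂ E) : Set E) := by
      ext d
      constructor
      · rintro ⟨m, hm, hmd⟩
        have hmd : T m = T d := hmd
        refine Submodule.mem_sup.2 ⟨m, hm, d - m, ⟨DD.sub_mem d.2 (hMD hm), ?_⟩, by abel⟩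
        simp [hmd]
      · intro hd
        obtain ⟨m, hm, k, hk, hmk⟩ := Submodule.mem_sup.1 hd
        refine ⟨m, hm, ?_⟩
        have hk0 : T k = 0 := hk.2
        change T m = T d
        have hmk' : m + k = (d : E) := hmk
        rw [← hmk', map_add, hk0, add_zero]
    rw [this]
    exact hsup.preimage continuous_subtype_val
  have hcl2 : IsClosed (T '' (M : Set E)) := by
    have h := hr.isClosedEmbedding_subtypeVal.isClosedMap _ hcl1
    convert h using 1
    ext y
    constructor
    · rintro ⟨m, hm, rfl⟩
      exact ⟨⟨T m, m, hMD hm, rfl⟩, ⟨m, hm, rfl⟩, rfl⟩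
    · rintro ⟨r, hr, rfl⟩
      exact hr
  obtain ⟨c, hc⟩ := (T.comp M.subtypeL).antilipschitz_of_injective_of_isClosed_range
    (by
      rw [injective_iff_map_eq_zero]
      intro m hm
      exact Subtype.ext (hinj m m.2 hm))
    (by
      convert hcl2 using 1
      ext y
      simp)
  refine ⟨((c : ℝ) + 1)⁻¹, by positivity, fun m hm => ?_⟩
  have := hc.le_mul_norm (map_zero _) (⟨m, hm⟩ : M)
  have h' : ‖m‖ ≤ c * ‖T m‖ := this
  rw [inv_mul_le_iff₀ (by positivity)]
  nlinarith [norm_nonneg (T m)]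

end AbstractLemmas
section Concrete

/-- The graph of `A†` as a subspace of the Hilbert sum `H ⊕ H`. -/
def graphG (A : H →ₗ.[ℂ] H) : Submodule ℂ (WithLp 2 (H × H)) :=
  A.adjoint.graph.comap (WithLp.linearEquiv 2 ℂ (H × H)).toLinearMap

/-- The map `x ↦ (x, A† x)`. -/
def graphE (A : H →ₗ.[ℂ] H) : A.adjoint.domain →ₗ[ℂ] graphG A where
  toFun x := ⟨WithLp.toLp 2 ((x : H), A.adjoint x), A.adjoint.mem_graph x⟩
  map_add' x y := by
    apply Subtype.ext
    apply (WithLp.linearEquiv 2 ℂ (H × H)).injective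
    simp [A.adjoint.map_add]
  map_smul' c x := by
    apply Subtype.ext
    apply (WithLp.linearEquiv 2 ℂ (H × H)).injective
    simp [A.adjoint.map_smul]

lemma graphE_surj (A : H →ₗ.[ℂ] H) (k : graphG A) : ∃ x, graphE A x = k := by
  obtain ⟨k, hk⟩ := k
  obtain ⟨x, h1, h2⟩ := (LinearPMap.mem_graph_iff _).1 hk
  refine ⟨x, Subtype.ext ?_⟩
  apply (WithLp.linearEquiv 2 ℂ (H × H)).injective
  exact Prod.ext h1 h2

lemma graphE_inj (A : H →ₗ.[ℂ] H) : Function.Injective (graphE A) := by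
  intro x y h
  have := congrArg (fun k : graphG A => (k : WithLp 2 (H × H)).fst) h
  exact Subtype.ext this

lemma graphE_norm (A : H →ₗ.[ℂ] H) (x : A.adjoint.domain) : ‖graphE A x‖ = graphNorm A x := by
  rw [Submodule.coe_norm, WithLp.prod_norm_eq_of_L2]
  rfl

lemma graphG_closed (A : H →ₗ.[ℂ] H) (hdense : Dense (A.domain : Set H)) :
    IsClosed (graphG A : Set (WithLp 2 (H × H))) := by
  have h : IsClosed (A.adjoint.graph : Set (H × H)) := LinearPMap.adjoint_isClosed hdense
  exact h.preimage (WithLp.prodContinuousLinearEquiv 2 ℂ H H).continuous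

/-- `A† + C` as a bounded operator on the graph space. -/
def pertT (A : H →ₗ.[ℂ] H) (C : H →L[ℂ] H) : graphG A →L[ℂ] H :=
  (WithLp.sndL 2 ℂ H H + C.comp (WithLp.fstL 2 ℂ H H)).comp (graphG A).subtypeL

lemma pertT_apply (A : H →ₗ.[ℂ] H) (C : H →L[ℂ] H) (x : A.adjoint.domain) :
    pertT A C (graphE A x) = A.adjoint x + C (x : H) := rfl

lemma pertT_cont (A : H →ₗ.[ℂ] H) (C : ℝ → H →L[ℂ] H) (hC : Continuous C) :
    Continuous fun t => pertT A (C t) := by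
  unfold pertT
  fun_prop

lemma le_adj (A : H →ₗ.[ℂ] H) (hdense : Dense (A.domain : Set H))
    (hsym : ∀ x y : A.domain, ⟪A x, (y : H)⟫ = ⟪(x : H), A y⟫) : A ≤ A.adjoint :=
  LinearPMap.IsFormalAdjoint.le_adjoint hdense hsym

lemma minDom_map_closed (A : H →ₗ.[ℂ] H) (hle : A ≤ A.adjoint)
    (hclosed : IsClosed (A.graph : Set (H × H))) :
    IsClosed (((minDom A).map (graphE A) : Submodule ℂ (graphG A)) : Set (graphG A)) := by
  have h : (((minDom A).map (graphE A) : Submodule ℂ (graphG A)) : Set (graphG A)) =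
      (fun k : graphG A => WithLp.prodContinuousLinearEquiv 2 ℂ H H k) ⁻¹' A.graph := by
    ext k
    obtain ⟨x, rfl⟩ := graphE_surj A k
    constructor
    · rintro ⟨y, hy, hyx⟩
      obtain rfl := graphE_inj A hyx
      exact (LinearPMap.mem_graph_iff _).2 ⟨⟨y, hy⟩, rfl, hle.2 rfl⟩
    · intro hx
      obtain ⟨y, h1, h2⟩ := (LinearPMap.mem_graph_iff _).1 hx
      refine ⟨x, ?_, rfl⟩
      change (x : H) ∈ A.domain
      have h1 : (y : H) = x := h1
      rw [← h1]; exact y.2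
  rw [h]
  exact hclosed.preimage
    ((WithLp.prodContinuousLinearEquiv 2 ℂ H H).continuous.comp continuous_subtype_val)

lemma D_map_closed (A : H →ₗ.[ℂ] H) (D : Submodule ℂ A.adjoint.domain)
    (hsa : IsSelfAdjoint (adjRestrict A D)) :
    IsClosed ((D.map (graphE A) : Submodule ℂ (graphG A)) : Set (graphG A)) := by
  have hcl : IsClosed ((adjRestrict A D).graph : Set (H × H)) := hsa.isClosed
  have h : ((D.map (graphE A) : Submodule ℂ (graphG A)) : Set (graphG A)) =
      (fun k : graphG A => WithLp.prodContinuousLinearEquiv 2 ℂ H H k) ⁻¹'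
        (adjRestrict A D).graph := by
    ext k
    obtain ⟨x, rfl⟩ := graphE_surj A k
    constructor
    · rintro ⟨y, hy, hyx⟩
      obtain rfl := graphE_inj A hyx
      exact (LinearPMap.mem_graph_iff _).2 ⟨⟨y, ⟨y, hy, rfl⟩, y.2⟩, rfl,
        LinearPMap.domRestrict_apply rfl⟩
    · intro hx
      obtain ⟨y, h1, h2⟩ := (LinearPMap.mem_graph_iff _).1 hx
      have h1 : (y : H) = x := h1
      obtain ⟨z, hz, hzy⟩ := y.2.1
      refine ⟨z, hz, ?_⟩
      congr 1
      exact Subtype.ext (hzy.trans h1)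
  rw [h]
  exact hcl.preimage
    ((WithLp.prodContinuousLinearEquiv 2 ℂ H H).continuous.comp continuous_subtype_val)

lemma addBdd_adj (A : H →ₗ.[ℂ] H) (hdense : Dense (A.domain : Set H)) (C : H →L[ℂ] H)
    (hC : IsSelfAdjoint C) (x : A.adjoint.domain) :
    ∃ h : (x : H) ∈ (addBdd A C).adjoint.domain,
      (addBdd A C).adjoint ⟨x, h⟩ = A.adjoint x + C (x : H) := by
  have hd : Dense ((addBdd A C).domain : Set H) := by
    have : (addBdd A C).domain = A.domain := by
      simp [addBdd, LinearPMap.add_domain]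
    rwa [this]
  have key : ∀ y : (addBdd A C).domain,
      ⟪A.adjoint x + C (x : H), (y : H)⟫ = ⟪(x : H), addBdd A C y⟫ := by
    intro y
    have e : addBdd A C y = A ⟨y, y.2.1⟩ + C (y : H) := rfl
    rw [e, inner_add_left, inner_add_right]
    congr 1
    · exact LinearPMap.adjoint_isFormalAdjoint hdense x ⟨y, y.2.1⟩
    · exact hC.isSymmetric _ _
  have hm := LinearPMap.mem_adjoint_domain_of_exists (T := addBdd A C) (x : H) ⟨_, key⟩
  exact ⟨hm, LinearPMap.adjoint_apply_eq hd ⟨x, hm⟩ key⟩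

lemma pert_range (A : H →ₗ.[ℂ] H) (hdense : Dense (A.domain : Set H)) (C : H →L[ℂ] H)
    (hC : IsSelfAdjoint C) (D : Submodule ℂ A.adjoint.domain) :
    LinearMap.range (pertRestrict A C D).toFun =
      (D.map (graphE A)).map (pertT A C).toLinearMap := by
  ext y
  constructor
  · rintro ⟨⟨x, ⟨z, hz, hzx⟩, hx2⟩, rfl⟩
    obtain rfl : (z : H) = x := hzx
    obtain ⟨h, he⟩ := addBdd_adj A hdense C hC z
    refine ⟨graphE A z, ⟨z, hz, rfl⟩, ?_⟩
    refine (pertT_apply A C z).trans ?_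
    rw [← he]
    exact (LinearPMap.domRestrict_apply rfl).symm
  · rintro ⟨_, ⟨z, hz, rfl⟩, rfl⟩
    obtain ⟨h, he⟩ := addBdd_adj A hdense C hC z
    refine ⟨⟨z, ⟨z, hz, rfl⟩, h⟩, ?_⟩
    refine Eq.trans ?_ (he.trans (pertT_apply A C z).symm)
    exact LinearPMap.domRestrict_apply (f := (addBdd A C).adjoint) rfl

lemma pert_ker (A : H →ₗ.[ℂ] H) (hdense : Dense (A.domain : Set H)) (C : H →L[ℂ] H)
    (hC : IsSelfAdjoint C) (D : Submodule ℂ A.adjoint.domain)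
    (hk : FiniteDimensional ℂ (LinearMap.ker (pertRestrict A C D).toFun)) :
    FiniteDimensional ℂ (D.map (graphE A) ⊓ (pertT A C).ker : Submodule ℂ (graphG A)) := by
  let N : Submodule ℂ H :=
    (LinearMap.ker (pertRestrict A C D).toFun).map (pertRestrict A C D).domain.subtype
  have hN : FiniteDimensional ℂ N := inferInstance
  let F : Submodule ℂ (graphG A) := D.map (graphE A) ⊓ (pertT A C).ker
  let φ : F →ₗ[ℂ] H :=
    ((WithLp.fstL 2 ℂ H H).toLinearMap.comp (graphG A).subtype).comp F.subtype
  have hφ : ∀ k, φ k ∈ N := by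
    rintro ⟨_, ⟨z, hz, rfl⟩, hk0⟩
    obtain ⟨h, he⟩ := addBdd_adj A hdense C hC z
    have hk0 : A.adjoint z + C (z : H) = 0 := hk0
    refine ⟨⟨z, ⟨z, hz, rfl⟩, h⟩, ?_, rfl⟩
    refine Eq.trans ?_ (he.trans hk0)
    exact LinearPMap.domRestrict_apply (f := (addBdd A C).adjoint) rfl
  refine Module.Finite.of_injective (φ.codRestrict N hφ) ?_
  intro k₁ k₂ h
  have hφe : φ k₁ = φ k₂ := congrArg Subtype.val h
  obtain ⟨x, hx⟩ := graphE_surj A k₁.1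
  obtain ⟨y, hy⟩ := graphE_surj A k₂.1
  apply Subtype.ext
  have e1 : φ k₁ = x := by
    change ((k₁.1 : WithLp 2 (H × H))).fst = x
    rw [← hx]; rfl
  have e2 : φ k₂ = y := by
    change ((k₂.1 : WithLp 2 (H × H))).fst = y
    rw [← hy]; rfl
  rw [← hx, ← hy]
  congr 1
  apply Subtype.ext
  rw [← e1, ← e2, hφe]

/-- The graph of a closed operator, via orthogonality: `A†† ⊆ A`. -/
lemma mem_graph_of (A : H →ₗ.[ℂ] H) (hdense : Dense (A.domain : Set H))
    (hclosed : IsClosed (A.graph : Set (H × H))) (y w : H)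
    (h : ∀ x : A.adjoint.domain, ⟪A.adjoint x, y⟫ = ⟪(x : H), w⟫) : (y, w) ∈ A.graph := by
  let M : Submodule ℂ (WithLp 2 (H × H)) :=
    A.graph.comap (WithLp.linearEquiv 2 ℂ (H × H)).toLinearMap
  have hM : IsClosed (M : Set (WithLp 2 (H × H))) :=
    hclosed.preimage (WithLp.prodContinuousLinearEquiv 2 ℂ H H).continuous
  have hc : CompleteSpace M := hM.completeSpace_coe
  suffices WithLp.toLp 2 (y, w) ∈ Mᗮᗮ by
    rw [Submodule.orthogonal_orthogonal] at this
    exact this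
  rw [Submodule.mem_orthogonal]
  intro u hu
  rw [Submodule.mem_orthogonal'] at hu
  have hu' : ∀ x : A.domain, ⟪-u.fst, (x : H)⟫ = ⟪u.snd, A x⟫ := by
    intro x
    have := hu (WithLp.toLp 2 ((x : H), A x)) (A.mem_graph x)
    rw [WithLp.prod_inner_apply] at this
    rw [inner_neg_left]
    exact neg_eq_of_add_eq_zero_right this
  have hm := LinearPMap.mem_adjoint_domain_of_exists (T := A) u.snd ⟨_, hu'⟩
  have he := LinearPMap.adjoint_apply_eq hdense ⟨u.snd, hm⟩ hu'
  have := h ⟨u.snd, hm⟩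
  rw [he, inner_neg_left] at this
  rw [WithLp.prod_inner_apply]
  change ⟪u.fst, y⟫ + ⟪u.snd, w⟫ = 0
  rw [← this]
  ring

lemma pertT_surj (A : H →ₗ.[ℂ] H) (hdense : Dense (A.domain : Set H))
    (hclosed : IsClosed (A.graph : Set (H × H))) (hle : A ≤ A.adjoint)
    (D : Submodule ℂ A.adjoint.domain) (C : H →L[ℂ] H) (hC : IsSelfAdjoint C)
    (hranF : IsClosed ((LinearMap.range (pertRestrict A C D).toFun : Submodule ℂ H) : Set H))
    (hcokerF : FiniteDimensional ℂ (H ⧸ LinearMap.range (pertRestrict A C D).toFun))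
    (hU : ∀ x : A.adjoint.domain, A.adjoint x + C (x : H) = 0 → (x : H) ∈ A.domain → x = 0) :
    (pertT A C).range = ⊤ := by
  have hcl : IsClosed (((pertT A C).range : Submodule ℂ H) : Set H) := by
    refine Submodule.isClosed_mono_of_finiteDimensional_quotient hranF ?_
    rw [pert_range A hdense C hC D]
    exact LinearMap.map_le_range
  have : CompleteSpace (pertT A C).range := hcl.completeSpace_coe
  rw [← Submodule.orthogonal_eq_bot_iff, Submodule.eq_bot_iff]
  intro y hy
  rw [Submodule.mem_orthogonal] at hy
  have hg : (y, -C y) ∈ A.graph := by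
    refine mem_graph_of A hdense hclosed y (-C y) fun x => ?_
    have h := hy _ ⟨graphE A x, rfl⟩
    have h : ⟪A.adjoint x + C (x : H), y⟫ = 0 := h
    have hs : ⟪C (x : H), y⟫ = ⟪(x : H), C y⟫ := hC.isSymmetric _ _
    rw [inner_add_left, hs] at h
    rw [inner_neg_right]
    exact eq_neg_of_add_eq_zero_left h
  obtain ⟨z, h1, h2⟩ := (LinearPMap.mem_graph_iff _).1 hg
  have h1 : (z : H) = y := h1
  have h2 : A z = - C y := h2
  have hz := hU ⟨z, hle.1 z.2⟩ (by
    rw [← hle.2 (x := z) rfl, h2, ← h1]; simp) z.2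
  rw [← h1]
  exact congrArg Subtype.val hz

end Concrete

lemma exists_j (A : H →ₗ.[ℂ] H) [((minDom A).map (graphE A)).HasOrthogonalProjection] :
    ∃ j : beta A →ₗ[ℂ] graphG A,
      (∀ x, j (gammaMap A x) = ((minDom A).map (graphE A))ᗮ.starProjection (graphE A x)) ∧
      ∀ v, quotNorm A v = ‖j v‖ := by
  set M := (minDom A).map (graphE A) with hM
  let j : beta A →ₗ[ℂ] graphG A :=
    (minDom A).liftQ (Mᗮ.starProjection.toLinearMap.comp (graphE A)) (by
      intro x hx
      change Mᗮ.starProjection (graphE A x) = 0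
      rw [Submodule.starProjection_apply_eq_zero_iff]
      exact Submodule.le_orthogonal_orthogonal _ ⟨x, hx, rfl⟩)
  have hj : ∀ x, j (gammaMap A x) = Mᗮ.starProjection (graphE A x) := fun x => rfl
  refine ⟨j, hj, fun v => ?_⟩
  obtain ⟨x, rfl⟩ := (minDom A).mkQ_surjective v
  change quotNorm A (gammaMap A x) = ‖j (gammaMap A x)‖
  refine IsLeast.csInf_eq ⟨?_, ?_⟩
  · obtain ⟨y, hy, hyx⟩ := M.starProjection_apply_mem (graphE A x)
    refine ⟨x - y, ?_, ?_⟩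
    · change gammaMap A (x - y) = gammaMap A x
      have : gammaMap A y = 0 := (Submodule.Quotient.mk_eq_zero _).2 hy
      rw [map_sub, this, sub_zero]
    · rw [hj, ← graphE_norm, map_sub, hyx]
      congr 1
      rw [sub_eq_iff_eq_add, add_comm]
      exact (M.starProjection_add_starProjection_orthogonal _).symm
  · rintro _ ⟨y, hy, rfl⟩
    have hy : gammaMap A y = gammaMap A x := hy
    rw [← hy, hj, ← graphE_norm]
    exact Mᗮ.norm_starProjection_apply_le _

/-- Let `A_D := A†|_D` be a self-adjoint extension and `t ↦ C t` a
norm-continuous curve of bounded self-adjoint operators such that each `(A + C t)_D` is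
self-adjoint Fredholm and each `A + C t` satisfies weak inner unique continuation with
margin.  Then the curve `t ↦ CD(A + C t) = γ(ker (A† + C t))` of closed subspaces of `β(A)`
is continuous: the orthogonal projections `P t` of `β(A)` onto `CD(A + C t)` (with respect to
the inner product induced by the graph inner product of `A†`, characterized metrically as
nearest-point projections for the quotient norm) depend norm-continuously on `t`. -/
theorem cauchyData_curve_continuous
    [TopologicalSpace.SeparableSpace H]
    (A : H →ₗ.[ℂ] H)
    (hdense : Dense (A.domain : Set H))
    (hclosed : IsClosed (A.graph : Set (H × H)))
    (hsym : ∀ x y : A.domain, ⟪A x, (y : H)⟫ = ⟪(x : H), A y⟫)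
    (D : Submodule ℂ A.adjoint.domain)
    (hD : minDom A ≤ D)
    (hsa : IsSelfAdjoint (adjRestrict A D))
    (C : ℝ → H →L[ℂ] H)
    (hCcont : Continuous C)
    (hCsa : ∀ t : ℝ, IsSelfAdjoint (C t))
    (hsaF : ∀ t : ℝ, IsSelfAdjoint (pertRestrict A (C t) D))
    (hkerF : ∀ t : ℝ, FiniteDimensional ℂ (LinearMap.ker (pertRestrict A (C t) D).toFun))
    (hranF : ∀ t : ℝ,
      IsClosed ((LinearMap.range (pertRestrict A (C t) D).toFun : Submodule ℂ H) : Set H))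
    (hcokerF : ∀ t : ℝ, FiniteDimensional ℂ (H ⧸ LinearMap.range (pertRestrict A (C t) D).toFun))
    (hUCP : ∀ t : ℝ, ∃ ε > (0 : ℝ), ∀ s : ℝ, |s| < ε →
      ∀ x : A.adjoint.domain,
        A.adjoint x + C t (x : H) + (s : ℂ) • (x : H) = 0 → (x : H) ∈ A.domain → x = 0) :
    ∀ P : ℝ → beta A → beta A,
      (∀ (t : ℝ) (v : beta A), P t v ∈ pertCauchyData A (C t) ∧
          ∀ w ∈ pertCauchyData A (C t), quotNorm A (v - P t v) ≤ quotNorm A (v - w)) →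
      ∀ t : ℝ, ∀ ε > (0 : ℝ), ∃ δ > (0 : ℝ), ∀ s : ℝ, |s - t| < δ →
        ∀ v : beta A, quotNorm A (P s v - P t v) ≤ ε * quotNorm A v := by
  intro P hP t ε hε
  have hle := le_adj A hdense hsym
  have hGc : CompleteSpace (graphG A) := (graphG_closed A hdense).completeSpace_coe
  have hMcl := minDom_map_closed A hle hclosed
  have hMc : CompleteSpace ((minDom A).map (graphE A)) := hMcl.completeSpace_coe
  obtain ⟨j, hj, hjn⟩ := exists_j A
  have hU : ∀ x : A.adjoint.domain,
      A.adjoint x + C t (x : H) = 0 → (x : H) ∈ A.domain → x = 0 := by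
    intro x hx hxA
    obtain ⟨r, hr, h⟩ := hUCP t
    exact h 0 (by simpa using hr) x (by simpa using hx) hxA
  have hsurj := pertT_surj A hdense hclosed hle D (C t) (hCsa t) (hranF t) (hcokerF t) hU
  obtain ⟨a, ha, haM⟩ := aux_semiFredholm (pertT A (C t)) (D.map (graphE A))
    ((minDom A).map (graphE A)) (D_map_closed A D hsa) hMcl (Submodule.map_mono hD)
    (by rw [← pert_range A hdense (C t) (hCsa t) D]; exact hranF t)
    (pert_ker A hdense (C t) (hCsa t) D (hkerF t))
    (by
      rintro _ ⟨x, hx, rfl⟩ h0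
      rw [hU x h0 hx, map_zero])
  obtain ⟨δ, hδ, hmain⟩ := aux_main (fun t => pertT A (C t)) (pertT_cont A C hCcont)
    ((minDom A).map (graphE A)) t hsurj a ha haM ε hε
  have himg : ∀ s, ((((pertCauchyData A (C s)).map j : Submodule ℂ (graphG A))) :
      Set (graphG A)) =
      ((minDom A).map (graphE A))ᗮ.starProjection '' {z | pertT A (C s) z = 0} := by
    intro s
    ext k
    constructor
    · rintro ⟨_, ⟨x, hx, rfl⟩, rfl⟩
      exact ⟨graphE A x, hx, (hj x).symm⟩
    · rintro ⟨z, hz, rfl⟩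
      obtain ⟨x, rfl⟩ := graphE_surj A z
      exact ⟨_, ⟨x, hz, rfl⟩, hj x⟩
  have horth : ∀ s v, ∀ w ∈ (pertCauchyData A (C s)).map j, ⟪j v - j (P s v), w⟫ = 0 := by
    intro s v
    obtain ⟨h1, h2⟩ := hP s v
    rw [← Submodule.norm_eq_iInf_iff_inner_eq_zero _ (Submodule.mem_map_of_mem h1)]
    refine le_antisymm (le_ciInf ?_) ?_
    · rintro ⟨_, w, hw, rfl⟩
      have := h2 w hw
      rwa [hjn, hjn, map_sub, map_sub] at this
    · refine ciInf_le (f := fun w : (pertCauchyData A (C s)).map j => ‖j v - w‖)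
        ⟨0, ?_⟩ ⟨_, Submodule.mem_map_of_mem h1⟩
      rintro _ ⟨w, rfl⟩
      exact norm_nonneg _
  refine ⟨δ, hδ, fun s hs v => ?_⟩
  rw [hjn, hjn, map_sub]
  refine hmain s hs (j v) (j (P s v)) (j (P t v)) ?_ ?_ ?_ ?_
  · rw [← himg]; exact Submodule.mem_map_of_mem (hP s v).1
  · rw [← himg]; exact Submodule.mem_map_of_mem (hP t v).1
  · rw [← himg]; exact horth s v
  · rw [← himg]; exact horth t v
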